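/- For every φ in the half-open interval [0, 1), ∫_φ^1 s^{5/2} / √((1−s)(s² + s − φ³)) ds ≤ E(φ)·F(φ) + φ³·G(φ). -/

import Mathlib

open intervalIntegral

noncomputable def E (φ : ℝ) : ℝ :=
  Real.sqrt (1 + φ) / Real.sqrt (1 + φ - φ ^ 2) - (1 / 2) * φ ^ 2 / (1 + φ)

noncomputable def F (φ : ℝ) : ℝ :=
  Real.pi / 4 + (1 / 2) * φ * Real.sqrt (1 - φ ^ 2) - (1 / 2) * Real.arcsin φ

noncomputable def G (φ : ℝ) : ℝ :=
  Real.pi / 4 - (1 / 2) * Real.sqrt ((1 - φ) / (1 + φ)) - (1 / 2) * Real.arcsin φ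

lemma inv_sqrt_one_sub_sub_half_le {u m : ℝ} (hu : 0 ≤ u) (hum : u ≤ m) (hm : m < 1) :
    1 / Real.sqrt (1 - u) ≤ 1 / Real.sqrt (1 - m) - m / 2 + u / 2 := by
  have hb : 0 < Real.sqrt (1 - m) := Real.sqrt_pos.2 (by linarith)
  have hba : Real.sqrt (1 - m) ≤ Real.sqrt (1 - u) := Real.sqrt_le_sqrt (by linarith)
  have ha1 : Real.sqrt (1 - u) ≤ 1 := Real.sqrt_le_one.2 (by linarith)
  have ha2 := Real.sq_sqrt (show 0 ≤ 1 - u by linarith)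
  have hb2 := Real.sq_sqrt (show 0 ≤ 1 - m by linarith)
  set a := Real.sqrt (1 - u)
  set b := Real.sqrt (1 - m)
  have ha : 0 < a := hb.trans_le hba
  have hu' : u = 1 - a ^ 2 := by linarith
  have hm' : m = 1 - b ^ 2 := by linarith
  have key : (a - b) * (a + b) / 2 ≤ (a - b) / (a * b) := by
    rw [le_div_iff₀ (by positivity)]
    have hab : a * b ≤ 1 := by nlinarith
    have h2 : (a + b) / 2 * (a * b) ≤ 1 := by
      have : (a + b) / 2 ≤ 1 := by linarith
      nlinarith [mul_pos ha hb]
    nlinarith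
  have hsub : (a - b) / (a * b) = 1 / b - 1 / a := by field_simp
  rw [hsub] at key
  rw [hu', hm']
  nlinarith

lemma hasDerivAt_arcsin_sub_mul_sqrt {s : ℝ} (h0 : -1 < s) (h1 : s < 1) :
    HasDerivAt (fun x => (Real.arcsin x - x * Real.sqrt (1 - x ^ 2)) / 2)
      (s ^ 2 / Real.sqrt (1 - s ^ 2)) s := by
  have hpos : 0 < 1 - s ^ 2 := by nlinarith
  have hr := Real.sqrt_pos.2 hpos
  have hr2 := Real.sq_sqrt hpos.le
  have hsq : HasDerivAt (fun x : ℝ => 1 - x ^ 2) (-(2 * s)) s := by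
    simpa using (hasDerivAt_pow 2 s).const_sub 1
  have h := ((Real.hasDerivAt_arcsin h0.ne' h1.ne).sub
    ((hasDerivAt_id' s).mul (hsq.sqrt hpos.ne'))).div_const 2
  refine h.congr_deriv ?_
  field_simp
  rw [hr2]
  ring

lemma hasDerivAt_arcsin_add_sqrt_div {s : ℝ} (h0 : -1 < s) (h1 : s < 1) :
    HasDerivAt (fun x => Real.arcsin x + Real.sqrt ((1 - x) / (1 + x)))
      (s / ((1 + s) * Real.sqrt (1 - s ^ 2))) s := by
  have hp : 0 < 1 + s := by linarith
  have hq : 0 < 1 - s := by linarith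
  have hpos : 0 < 1 - s ^ 2 := by nlinarith
  have hr := Real.sqrt_pos.2 hpos
  have hr2 := Real.sq_sqrt hpos.le
  have hsqrt : Real.sqrt ((1 - s) / (1 + s)) = Real.sqrt (1 - s ^ 2) / (1 + s) := by
    rw [show (1 - s) / (1 + s) = (1 - s ^ 2) / (1 + s) ^ 2 by field_simp; ring,
      Real.sqrt_div hpos.le, Real.sqrt_sq hp.le]
  have hd := ((hasDerivAt_id' s).const_sub 1).div ((hasDerivAt_id' s).const_add 1) hp.ne'
  have h := (Real.hasDerivAt_arcsin h0.ne' h1.ne).add (hd.sqrt (div_pos hq hp).ne')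
  refine h.congr_deriv ?_
  simp only [Pi.div_apply]
  rw [hsqrt]
  field_simp
  ring

lemma rpow_div_sqrt_eq {s c : ℝ} (h0 : 0 < s) (h1 : s < 1) :
    s ^ ((5:ℝ)/2) / Real.sqrt ((1 - s) * (s ^ 2 + s - c)) =
      s ^ 2 / Real.sqrt (1 - s ^ 2) * (1 / Real.sqrt (1 - c / (s * (1 + s)))) := by
  have hpos : 0 < 1 - s ^ 2 := by nlinarith
  have hs : 0 < Real.sqrt s := Real.sqrt_pos.2 h0
  have hpow : s ^ ((5:ℝ)/2) = s ^ 2 * Real.sqrt s := by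
    rw [show (5:ℝ)/2 = (2:ℕ) + 1/2 by norm_num, Real.rpow_add h0, Real.rpow_natCast,
      Real.sqrt_eq_rpow]
  have hprod : (1 - s) * (s ^ 2 + s - c) = s * ((1 - s ^ 2) * (1 - c / (s * (1 + s)))) := by
    field_simp
    ring
  rw [hpow, hprod, Real.sqrt_mul h0.le, Real.sqrt_mul hpos.le, mul_comm (s ^ 2),
    mul_div_mul_left _ _ hs.ne', div_mul_div_comm, mul_one]

lemma E_eq {φ : ℝ} (h0 : 0 ≤ φ) :
    E φ = 1 / Real.sqrt (1 - φ ^ 2 / (1 + φ)) - φ ^ 2 / (1 + φ) / 2 := by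
  have hp : 0 < 1 + φ := by linarith
  have h : 1 - φ ^ 2 / (1 + φ) = (1 + φ - φ ^ 2) / (1 + φ) := by field_simp
  rw [E, h, Real.sqrt_div' _ hp.le, one_div_div]
  ring

lemma rpow_div_sqrt_le {φ s : ℝ} (h0 : 0 ≤ φ) (hs : φ < s) (h1 : s < 1) :
    s ^ ((5:ℝ)/2) / Real.sqrt ((1 - s) * (s ^ 2 + s - φ ^ 3)) ≤
      E φ * (s ^ 2 / Real.sqrt (1 - s ^ 2)) +
        φ ^ 3 / 2 * (s / ((1 + s) * Real.sqrt (1 - s ^ 2))) := by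
  have hs0 : 0 < s := h0.trans_lt hs
  have hr : 0 < Real.sqrt (1 - s ^ 2) := Real.sqrt_pos.2 (by nlinarith)
  have hum : φ ^ 3 / (s * (1 + s)) ≤ φ ^ 2 / (1 + φ) := by
    rw [div_le_div_iff₀ (by positivity) (by positivity)]
    have : φ * (1 + φ) ≤ s * (1 + s) := by gcongr
    nlinarith [mul_le_mul_of_nonneg_left this (sq_nonneg φ)]
  have hm : φ ^ 2 / (1 + φ) < 1 := by
    rw [div_lt_one (by positivity)]
    nlinarith
  rw [rpow_div_sqrt_eq hs0 h1, E_eq h0]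
  refine (mul_le_mul_of_nonneg_left
    (inv_sqrt_one_sub_sub_half_le (by positivity) hum hm) (by positivity)).trans_eq ?_
  rw [mul_add, mul_comm (s ^ 2 / _)]
  congr 1
  field_simp

theorem integral_le_EF_add_G (φ : ℝ) (hφ : φ ∈ Set.Ico (0:ℝ) 1) :
    (∫ s in φ..1, s ^ ((5:ℝ)/2) / Real.sqrt ((1 - s) * (s ^ 2 + s - φ ^ 3)))
      ≤ E φ * F φ + φ ^ 3 * G φ := by
  obtain ⟨h0, h1⟩ := hφ
  set H : ℝ → ℝ := fun x => E φ * ((Real.arcsin x - x * Real.sqrt (1 - x ^ 2)) / 2) +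
    φ ^ 3 / 2 * (Real.arcsin x + Real.sqrt ((1 - x) / (1 + x))) with hH
  set h : ℝ → ℝ := fun s => E φ * (s ^ 2 / Real.sqrt (1 - s ^ 2)) +
    φ ^ 3 / 2 * (s / ((1 + s) * Real.sqrt (1 - s ^ 2))) with hh
  have hcont : ContinuousOn H (Set.Icc φ 1) := by
    have hdiv : ContinuousOn (fun x : ℝ => (1 - x) / (1 + x)) (Set.Icc φ 1) :=
      ContinuousOn.div (by fun_prop) (by fun_prop) fun x hx => by linarith [hx.1]
    have harc := Real.continuous_arcsin
    exact (Continuous.continuousOn (by fun_prop)).add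
      (continuousOn_const.mul (harc.continuousOn.add hdiv.sqrt))
  have hderiv : ∀ s ∈ Set.Ioo φ 1, HasDerivAt H (h s) s := fun s hs =>
    ((hasDerivAt_arcsin_sub_mul_sqrt (by linarith [hs.1]) hs.2).const_mul _).add
      ((hasDerivAt_arcsin_add_sqrt_div (by linarith [hs.1]) hs.2).const_mul _)
  have hf0 : ∀ s ∈ Set.Ioc φ 1,
      0 ≤ s ^ ((5:ℝ)/2) / Real.sqrt ((1 - s) * (s ^ 2 + s - φ ^ 3)) := fun s hs =>
    div_nonneg (Real.rpow_nonneg (h0.trans hs.1.le) _) (Real.sqrt_nonneg _)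
  have hle : ∀ s ∈ Set.Ioc φ 1,
      s ^ ((5:ℝ)/2) / Real.sqrt ((1 - s) * (s ^ 2 + s - φ ^ 3)) ≤ h s := by
    intro s hs
    rcases hs.2.eq_or_lt with rfl | hs1
    · simp [hh]
    · exact rpow_div_sqrt_le h0 hs.1 hs1
  have hint : MeasureTheory.IntegrableOn h (Set.Ioc φ 1) :=
    integrableOn_deriv_of_nonneg hcont hderiv fun s hs =>
      (hf0 s ⟨hs.1, hs.2.le⟩).trans (hle s ⟨hs.1, hs.2.le⟩)
  calc (∫ s in φ..1, s ^ ((5:ℝ)/2) / Real.sqrt ((1 - s) * (s ^ 2 + s - φ ^ 3)))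
      ≤ ∫ s in φ..1, h s := by
        rw [integral_of_le h1.le, integral_of_le h1.le]
        exact MeasureTheory.integral_mono_of_nonneg
          (MeasureTheory.ae_restrict_of_forall_mem measurableSet_Ioc hf0) hint
          (MeasureTheory.ae_restrict_of_forall_mem measurableSet_Ioc hle)
    _ = H 1 - H φ := integral_eq_sub_of_hasDerivAt_of_le h1.le hcont hderiv
        ((intervalIntegrable_iff_integrableOn_Ioc_of_le h1.le).2 hint)
    _ = E φ * F φ + φ ^ 3 * G φ := by
        simp only [hH, F, G, Real.arcsin_one]
        norm_num
        ring
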